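/- arXiv:1304.4693 — 3 statements merged into one kernel-verified Lean document; each statement's English description precedes it below -/
import Mathlib

section
/- Fix an integer M ≥ 2 and a commutative ring R. Then the system matrix Q_sys ∈ R^{(2M−1)×(2M−1)} has determinant 1; in particular, Q_sys is invertible. -/
open Matrix

/-- `Q12 ∈ R^{M×(M−1)}`: the block matrix `[0_{1×(M−1)}; I_{M−1}]`,
i.e. `(Q12)_{i,j} = 1` iff `i = j + 1`. -/
def Q12 (R : Type*) [CommRing R] (M : ℕ) : Matrix (Fin M) (Fin (M - 1)) R :=
  Matrix.of fun i j => if (i : ℕ) = (j : ℕ) + 1 then 1 else 0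

/-- `Q21 ∈ R^{(M−1)×M}`: the block matrix `[I_{M−1} | 0_{(M−1)×1}]`,
i.e. `(Q21)_{i,j} = 1` iff `i = j`. -/
def Q21 (R : Type*) [CommRing R] (M : ℕ) : Matrix (Fin (M - 1)) (Fin M) R :=
  Matrix.of fun i j => if (i : ℕ) = (j : ℕ) then 1 else 0

/-- The `(2M−1)×(2M−1)` system matrix `Q_sys = [[I_M, Q12],[Q21, I_{M−1}]]`
(rows and columns indexed by `Fin M ⊕ Fin (M−1)`, a type of cardinality `2M−1`). -/
def Qsys (R : Type*) [CommRing R] (M : ℕ) :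
    Matrix (Fin M ⊕ Fin (M - 1)) (Fin M ⊕ Fin (M - 1)) R :=
  Matrix.fromBlocks 1 (Q12 R M) (Q21 R M) 1

theorem Q21_mul_Q12_apply (R : Type*) [CommRing R] (M : ℕ) (i j : Fin (M - 1)) :
    (Q21 R M * Q12 R M) i j = if (i : ℕ) = (j : ℕ) + 1 then 1 else 0 := by
  have hi : (i : ℕ) < M := by omega
  rw [Matrix.mul_apply, Finset.sum_eq_single ⟨i, hi⟩]
  · simp [Q21, Q12]
  · intro k _ hk
    have hne : (i : ℕ) ≠ k := fun h => hk (Fin.ext h.symm)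
    simp [Q21, hne]
  · simp

theorem det_Qsys (R : Type*) [CommRing R] (M : ℕ) : (Qsys R M).det = 1 := by
  rw [Qsys, Matrix.det_fromBlocks_one₁₁, Matrix.det_of_isLowerTriangular]
  · simp [Q21_mul_Q12_apply]
  · intro i j hij
    have hlt : (i : ℕ) < j := hij
    have hne : i ≠ j := fun h => hlt.ne (congrArg Fin.val h)
    have hne' : (i : ℕ) ≠ j + 1 := by omega
    simp [Q21_mul_Q12_apply, Matrix.one_apply_ne hne, hne']

/-- **Lemma 3 of the paper.** For any `M ≥ 2` and commutative ring `R`, the system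
matrix `Q_sys` has determinant `1`; in particular it is invertible. -/
theorem stmt4 (R : Type*) [CommRing R] (M : ℕ) (hM : 2 ≤ M) :
    (Qsys R M).det = 1 ∧ IsUnit (Qsys R M) := by
  exact ⟨det_Qsys R M, (Matrix.isUnit_iff_isUnit_det _).2 (by simp [det_Qsys])⟩
end

section
/- Fix an integer M ≥ 2 and a commutative ring R. Let M1 = (I_M − Q12·Q21)^{-1} and M2 = −(I_{M−1} − Q21·Q12)^{-1}. Then Q_sys · [[M1, 0],[0, M2]] · Q_sys = [[I_M, 0],[0, −I_{M−1}]], where [[M1,0],[0,M2]] and [[I_M,0],[0,−I_{M−1}]] denote the corresponding (2M−1)×(2M−1) block-diagonal matrices. -/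
open Matrix

/-- The relay precoding matrix `M1 = (I_M − Q12·Q21)⁻¹`. -/
noncomputable def M1 (R : Type*) [CommRing R] (M : ℕ) : Matrix (Fin M) (Fin M) R :=
  ((1 : Matrix (Fin M) (Fin M) R) - Q12 R M * Q21 R M)⁻¹

/-- The relay precoding matrix `M2 = −(I_{M−1} − Q21·Q12)⁻¹`. -/
noncomputable def M2 (R : Type*) [CommRing R] (M : ℕ) : Matrix (Fin (M - 1)) (Fin (M - 1)) R :=
  -((1 : Matrix (Fin (M - 1)) (Fin (M - 1)) R) - Q21 R M * Q12 R M)⁻¹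

/-- If `1 - A * B` is invertible, the precoders `(1 - A * B)⁻¹` and `-(1 - B * A)⁻¹` diagonalize
the block matrix `[[1, A], [B, 1]]`. -/
theorem fromBlocks_mul_precoders_mul_fromBlocks {m n R : Type*} [Fintype m] [DecidableEq m]
    [Fintype n] [DecidableEq n] [CommRing R] (A : Matrix m n R) (B : Matrix n m R)
    (h : IsUnit (1 - A * B).det) :
    fromBlocks 1 A B 1 * fromBlocks (1 - A * B)⁻¹ 0 0 (-(1 - B * A)⁻¹) * fromBlocks 1 A B 1
      = fromBlocks 1 0 0 (-1) := by
  have h' : IsUnit (1 - B * A).det := by rwa [← det_one_sub_mul_comm]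
  have hP := nonsing_inv_mul _ h
  have hN := mul_nonsing_inv _ h'
  have hA : (1 - A * B)⁻¹ * A = A * (1 - B * A)⁻¹ := by
    calc (1 - A * B)⁻¹ * A = (1 - A * B)⁻¹ * (A * ((1 - B * A) * (1 - B * A)⁻¹)) := by
          rw [hN, Matrix.mul_one]
      _ = (1 - A * B)⁻¹ * (1 - A * B) * (A * (1 - B * A)⁻¹) := by
          simp only [Matrix.mul_assoc, Matrix.sub_mul, Matrix.mul_sub, Matrix.one_mul]
      _ = A * (1 - B * A)⁻¹ := by rw [hP, Matrix.one_mul]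
  have hB : B * (1 - A * B)⁻¹ = (1 - B * A)⁻¹ * B := by
    calc B * (1 - A * B)⁻¹ = (1 - B * A)⁻¹ * (1 - B * A) * (B * (1 - A * B)⁻¹) := by
          rw [nonsing_inv_mul _ h', Matrix.one_mul]
      _ = (1 - B * A)⁻¹ * (B * ((1 - A * B) * (1 - A * B)⁻¹)) := by
          simp only [Matrix.mul_assoc, Matrix.sub_mul, Matrix.mul_sub, Matrix.one_mul]
      _ = (1 - B * A)⁻¹ * B := by rw [mul_nonsing_inv _ h, Matrix.mul_one]
  simp only [fromBlocks_multiply, Matrix.one_mul, Matrix.mul_one, Matrix.mul_zero, add_zero,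
    zero_add, Matrix.mul_neg, Matrix.neg_mul]
  congr 1
  · rw [Matrix.mul_sub, Matrix.mul_one] at hP
    rw [← hA, Matrix.mul_assoc, ← sub_eq_add_neg, hP]
  · rw [hA, add_neg_cancel]
  · rw [hB, add_neg_cancel]
  · rw [Matrix.sub_mul, Matrix.one_mul] at hN
    rw [Matrix.mul_assoc, hA, ← Matrix.mul_assoc, ← sub_eq_add_neg, ← neg_sub, hN]

theorem det_one_sub_Q21_mul_Q12 (R : Type*) [CommRing R] (M : ℕ) :
    (1 - Q21 R M * Q12 R M).det = 1 := by
  have key (i j : Fin (M - 1)) (hij : i ≤ j) : (Q21 R M * Q12 R M) i j = 0 := by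
    rw [mul_apply]
    refine Finset.sum_eq_zero fun k _ => ?_
    simp only [Q21, Q12, of_apply, mul_ite, mul_one, mul_zero]
    split_ifs <;> first | rfl | omega
  rw [det_of_isLowerTriangular]
  · exact Finset.prod_eq_one fun i _ => by simp [key i i le_rfl]
  · intro i j hij
    have hlt : i < j := hij
    rw [Matrix.sub_apply, key i j hlt.le, one_apply_ne hlt.ne, sub_zero]

/-- **Lemma 4 of the paper.** Choosing the relay precoding matrices
`M1 = (I_M − Q12·Q21)⁻¹` and `M2 = −(I_{M−1} − Q21·Q12)⁻¹` diagonalizes the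
end-to-end system matrix:
`Q_sys · diag(M1, M2) · Q_sys = diag(I_M, −I_{M−1})`. -/
theorem stmt6 (R : Type*) [CommRing R] (M : ℕ) (hM : 2 ≤ M) :
    Qsys R M * Matrix.fromBlocks (M1 R M) 0 0 (M2 R M) * Qsys R M
      = Matrix.fromBlocks (1 : Matrix (Fin M) (Fin M) R) 0 0
          (-(1 : Matrix (Fin (M - 1)) (Fin (M - 1)) R)) := by
  exact fromBlocks_mul_precoders_mul_fromBlocks _ _ <| by
    rw [det_one_sub_mul_comm, det_one_sub_Q21_mul_Q12]
    exact isUnit_one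
end

section
/- Let M, S ≥ 1 be integers, H ∈ ℂ^{M×M}, C ∈ ℂ^{M×S}, b ∈ ℂ^M, and let SNR > 0 be a real number. Then the S×S matrix SNR^{-1}·I_S + Cᴴ·Hᴴ·H·C is positive definite (in particular invertible), and the function f(α) = SNR·‖Cᴴ·(Hᴴ·α − b)‖² + ‖α‖², defined for α ∈ ℂ^M with ‖·‖ the Euclidean norm, attains a minimum over ℂ^M equal to the real number bᴴ·C·(SNR^{-1}·I_S + Cᴴ·Hᴴ·H·C)^{-1}·Cᴴ·b. -/
open Matrix
open scoped ComplexOrder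

/-- Completing the square in the regularised least-squares objective around the point `A *ᵥ w`,
where `w` solves the regularised normal equations. -/
theorem regularized_least_squares_complete_square {m n : Type*} [Fintype m] [Fintype n]
    [DecidableEq n] (A : Matrix m n ℂ) (s : ℝ) (hs : s ≠ 0) (w y : n → ℂ) (d : m → ℂ)
    (hw : ((s : ℂ)⁻¹ • (1 : Matrix n n ℂ) + Aᴴ * A) *ᵥ w = y) :
    (s : ℂ) * (star (Aᴴ *ᵥ (A *ᵥ w + d) - y) ⬝ᵥ (Aᴴ *ᵥ (A *ᵥ w + d) - y))
        + star (A *ᵥ w + d) ⬝ᵥ (A *ᵥ w + d)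
      = star w ⬝ᵥ y + ((s : ℂ) * (star (Aᴴ *ᵥ d) ⬝ᵥ (Aᴴ *ᵥ d)) + star d ⬝ᵥ d) := by
  have hs' : (s : ℂ) ≠ 0 := by exact_mod_cast hs
  have hres : Aᴴ *ᵥ (A *ᵥ w + d) - y = Aᴴ *ᵥ d - (s : ℂ)⁻¹ • w := by
    rw [← hw, add_mulVec, smul_mulVec, one_mulVec, mulVec_add, mulVec_mulVec]
    abel
  have hstar : star ((s : ℂ)⁻¹ • w) = (s : ℂ)⁻¹ • star w := by
    rw [star_smul]; simp
  have hcross₁ : star w ⬝ᵥ (Aᴴ *ᵥ d) = star (A *ᵥ w) ⬝ᵥ d := by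
    rw [star_mulVec, dotProduct_mulVec]
  have hcross₂ : star (Aᴴ *ᵥ d) ⬝ᵥ w = star d ⬝ᵥ (A *ᵥ w) := by
    rw [star_mulVec, conjTranspose_conjTranspose, dotProduct_mulVec]
  have hquad : star w ⬝ᵥ y = (s : ℂ)⁻¹ * (star w ⬝ᵥ w) + star (A *ᵥ w) ⬝ᵥ (A *ᵥ w) := by
    rw [← hw, add_mulVec, smul_mulVec, one_mulVec, dotProduct_add, dotProduct_smul, smul_eq_mul,
      star_mulVec, ← dotProduct_mulVec, mulVec_mulVec]
  rw [hres, hquad, star_sub, hstar, star_add]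
  simp only [sub_dotProduct, dotProduct_sub, add_dotProduct, dotProduct_add, smul_dotProduct,
    dotProduct_smul, smul_eq_mul, hcross₁, hcross₂]
  field_simp
  ring

theorem star_dotProduct_self_eq_sum_norm_sq {n : Type*} [Fintype n] (v : n → ℂ) :
    star v ⬝ᵥ v = ((∑ i, ‖v i‖ ^ 2 : ℝ) : ℂ) := by
  simp [dotProduct, Complex.conj_mul']

/-- **MMSE effective-noise-variance of compute-and-forward.** For `H ∈ ℂ^{M×M}`,
`C ∈ ℂ^{M×S}`, `b ∈ ℂ^M` and `SNR > 0`, the matrix `SNR⁻¹·I + Cᴴ·Hᴴ·H·C` is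
positive definite (in particular invertible), and the function
`f(α) = SNR·‖Cᴴ(Hᴴα − b)‖² + ‖α‖²` (Euclidean norms) attains its minimum over
`α ∈ ℂ^M`, the minimum value being the real number
`bᴴ·C·(SNR⁻¹·I + Cᴴ·Hᴴ·H·C)⁻¹·Cᴴ·b`. -/
theorem stmt11 (M S : ℕ) (hM : 1 ≤ M) (hS : 1 ≤ S)
    (H : Matrix (Fin M) (Fin M) ℂ) (C : Matrix (Fin M) (Fin S) ℂ)
    (b : Fin M → ℂ) (SNR : ℝ) (hSNR : 0 < SNR) :
    ((SNR : ℂ)⁻¹ • (1 : Matrix (Fin S) (Fin S) ℂ) + Cᴴ * Hᴴ * H * C).PosDef ∧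
    IsUnit ((SNR : ℂ)⁻¹ • (1 : Matrix (Fin S) (Fin S) ℂ) + Cᴴ * Hᴴ * H * C) ∧
    (star b ⬝ᵥ (C * ((SNR : ℂ)⁻¹ • (1 : Matrix (Fin S) (Fin S) ℂ)
        + Cᴴ * Hᴴ * H * C)⁻¹ * Cᴴ).mulVec b).im = 0 ∧
    IsLeast
      (Set.range fun α : Fin M → ℂ =>
        SNR * ∑ j : Fin S, ‖(Cᴴ.mulVec (Hᴴ.mulVec α - b)) j‖ ^ 2
          + ∑ i : Fin M, ‖α i‖ ^ 2)
      ((star b ⬝ᵥ (C * ((SNR : ℂ)⁻¹ • (1 : Matrix (Fin S) (Fin S) ℂ)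
        + Cᴴ * Hᴴ * H * C)⁻¹ * Cᴴ).mulVec b).re) := by
  have hQ : Cᴴ * Hᴴ * H * C = (H * C)ᴴ * (H * C) := by
    simp only [conjTranspose_mul, Matrix.mul_assoc]
  rw [hQ]
  set A := H * C with hA
  set Q := (SNR : ℂ)⁻¹ • (1 : Matrix (Fin S) (Fin S) ℂ) + Aᴴ * A
  have hpos : Q.PosDef := by
    have hinv : (0 : ℂ) < (SNR : ℂ)⁻¹ := by exact_mod_cast inv_pos.mpr hSNR
    exact (PosDef.one.smul hinv).add_posSemidef (posSemidef_conjTranspose_mul_self A)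
  set y := Cᴴ *ᵥ b with hy
  set w := Q⁻¹ *ᵥ y with hwdef
  have hw : Q *ᵥ w = y := by
    rw [hwdef, mulVec_mulVec, Q.mul_nonsing_inv ((Q.isUnit_iff_isUnit_det).mp hpos.isUnit),
      one_mulVec]
  have hval : star b ⬝ᵥ (C * Q⁻¹ * Cᴴ) *ᵥ b = star y ⬝ᵥ w := by
    rw [hwdef, hy, star_mulVec, conjTranspose_conjTranspose, ← dotProduct_mulVec, mulVec_mulVec,
      mulVec_mulVec, Matrix.mul_assoc]
  have hsymm : star w ⬝ᵥ y = star y ⬝ᵥ w := by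
    conv_rhs => rw [← hw, star_mulVec, hpos.isHermitian.eq, ← dotProduct_mulVec, hw]
  have hobj : ∀ d : Fin M → ℂ,
      ((SNR * ∑ j, ‖(Cᴴ *ᵥ (Hᴴ *ᵥ (A *ᵥ w + d) - b)) j‖ ^ 2
          + ∑ i, ‖(A *ᵥ w + d) i‖ ^ 2 : ℝ) : ℂ)
        = star y ⬝ᵥ w + ((SNR * ∑ j, ‖(Aᴴ *ᵥ d) j‖ ^ 2 + ∑ i, ‖d i‖ ^ 2 : ℝ) : ℂ) := by
    intro d
    have h := regularized_least_squares_complete_square A SNR hSNR.ne' w y d hw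
    have hres : Aᴴ *ᵥ (A *ᵥ w + d) - y = Cᴴ *ᵥ (Hᴴ *ᵥ (A *ᵥ w + d) - b) := by
      rw [mulVec_sub, hA, conjTranspose_mul, ← mulVec_mulVec (_ + d)]
    simp only [hres, hsymm, star_dotProduct_self_eq_sum_norm_sq, ← Complex.ofReal_mul,
      ← Complex.ofReal_add] at h
    exact h
  rw [hval]
  refine ⟨hpos, hpos.isUnit, ?_, ⟨A *ᵥ w, ?_⟩, ?_⟩
  · have h := congrArg Complex.im (hobj 0)
    rw [Complex.add_im, Complex.ofReal_im, Complex.ofReal_im, add_zero] at h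
    exact h.symm
  · have h := congrArg Complex.re (hobj 0)
    rw [Complex.add_re, Complex.ofReal_re, Complex.ofReal_re] at h
    simpa using h
  · rintro _ ⟨α, rfl⟩
    have h := congrArg Complex.re (hobj (α - A *ᵥ w))
    rw [Complex.add_re, Complex.ofReal_re, Complex.ofReal_re, add_sub_cancel] at h
    dsimp only
    rw [h]
    exact le_add_of_nonneg_right (by positivity)
end
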